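/- Let r > 0 and let the real coefficients satisfy u₀ = 1, u₁ = 0, v₂ = v₃ = v₄ = 0, v₁ = −u₄, u₂² + u₃² = 2u₄ and u₄ > 0. Then the polynomial identity F(x,y,z) = ( x² + (y + u₂/2)² + (z + u₃/2)² + u₄/2 − r² )² − 2u₄x² − (u₂y + u₃z + u₄)² holds for all (x,y,z). Consequently the zero set of F is a torus of revolution with major radius √(u₄/2) and minor radius r, centered at (0, −u₂/2, −u₃/2), with rotation axis in the direction (0, −u₃, u₂); in particular Γ is a principal circle of this torus wrapping around the torus tube. -/

import Mathlib

/-- The Darboux cyclide equation through the circle Γ, Lemma 3.1. -/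
def cyclF (u₀ u₁ u₂ u₃ u₄ v₁ v₂ v₃ v₄ r x y z : ℝ) : ℝ :=
  u₀*(x^2+y^2+z^2-r^2)^2 + 2*(x^2+y^2+z^2-r^2)*(u₁*x+u₂*y+u₃*z+u₄)
  + 2*x*(v₁*x+v₂*y+v₃*z+v₄)

/-- Proposition 6.8 (i): with u₀ = 1, u₁ = 0, v₂ = v₃ = v₄ = 0, v₁ = −u₄,
u₂² + u₃² = 2u₄ and u₄ > 0, the cyclide polynomial satisfies
F = (x² + (y+u₂/2)² + (z+u₃/2)² + u₄/2 − r²)² − 2u₄x² − (u₂y+u₃z+u₄)²,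
which is the canonical torus equation (X²+Y²+Z²+R²−ρ²)² − 4R²(X²+Y²) = 0 with
major radius R = √(u₄/2), minor radius ρ = r, center (0,−u₂/2,−u₃/2) and rotation
axis in direction (0,−u₃,u₂) (so X²+Y²+Z² = |p−c|², Z = (u₂z−u₃y)/√(2u₄));
in particular the circle Γ lies on this torus (as a principal circle wrapping
around the torus tube). -/
theorem stmt14 (r u₂ u₃ u₄ : ℝ) (hr : 0 < r)
    (h1 : u₂^2 + u₃^2 = 2*u₄) (h2 : 0 < u₄) :
    -- the polynomial identity
    (∀ x y z : ℝ,
      cyclF 1 0 u₂ u₃ u₄ (-u₄) 0 0 0 r x y z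
        = (x^2 + (y+u₂/2)^2 + (z+u₃/2)^2 + u₄/2 - r^2)^2
          - 2*u₄*x^2 - (u₂*y + u₃*z + u₄)^2)
    -- the zero set is the torus with R² = u₄/2, ρ = r, center (0,−u₂/2,−u₃/2),
    -- axis direction (0,−u₃,u₂): canonical form with X²+Y² = |p−c|² − Z²,
    -- Z = (u₂z−u₃y)/√(2u₄)
    ∧ (∀ x y z : ℝ,
      cyclF 1 0 u₂ u₃ u₄ (-u₄) 0 0 0 r x y z
        = ((x^2 + (y+u₂/2)^2 + (z+u₃/2)^2) + u₄/2 - r^2)^2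
          - 4*(u₄/2)*((x^2 + (y+u₂/2)^2 + (z+u₃/2)^2) - (u₂*z - u₃*y)^2/(2*u₄)))
    -- Γ lies on the torus
    ∧ (∀ y z : ℝ, y^2 + z^2 = r^2 → cyclF 1 0 u₂ u₃ u₄ (-u₄) 0 0 0 r 0 y z = 0) := by
  have hu : u₄ = (u₂^2 + u₃^2) / 2 := by linarith
  refine ⟨fun x y z => ?_, fun x y z => ?_, fun y z h => ?_⟩
  · subst hu
    unfold cyclF
    ring
  · have hne : u₄ ≠ 0 := h2.ne'
    have hq : 4*(u₄/2)*((x^2 + (y+u₂/2)^2 + (z+u₃/2)^2) - (u₂*z - u₃*y)^2/(2*u₄))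
        = 2*u₄*(x^2 + (y+u₂/2)^2 + (z+u₃/2)^2) - (u₂*z - u₃*y)^2 := by
      field_simp
      ring
    rw [hq, hu]
    unfold cyclF
    ring
  · simp [cyclF, h]
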